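/- arXiv:1410.0556 — 7 statements merged into one kernel-verified Lean document; each statement's English description precedes it below -/
import Mathlib

section
/- Let S ≥ 1 be a natural number. For every function ε : Fin S → ℝ taking values in {0,1}, one has (1/S) · ∑_{r ∈ Fin S} (1 − ε r) · ∏_{i ≠ r} (1 + ε i)/2 ≤ 1/S; moreover the value 1/S is attained (e.g. by any ε with exactly one coordinate equal to 0 and all other coordinates equal to 1). Equivalently, 1/S is the greatest element of the set of values { (1/S) · ∑_{r} (1 − ε r) · ∏_{i ≠ r} (1 + ε i)/2 : ε ∈ {0,1}^S }. -/
/-- Over a finite set, the sum `∑_r (1 - ε r) ∏_{i ≠ r} (1 + ε i)/2` for a `{0,1}`-valued `ε` lies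
in `[0, 1]`; the third bound, which is what adding a coordinate `0` requires, makes the
induction go through. -/
lemma sum_one_sub_mul_prod_half_bounds {ι : Type*} [DecidableEq ι] (ε : ι → ℝ)
    (hε : ∀ i, ε i = 0 ∨ ε i = 1) (s : Finset ι) :
    0 ≤ ∑ r ∈ s, (1 - ε r) * ∏ i ∈ s.filter (fun i => i ≠ r), (1 + ε i) / 2 ∧
    ∑ r ∈ s, (1 - ε r) * ∏ i ∈ s.filter (fun i => i ≠ r), (1 + ε i) / 2 ≤ 1 ∧
    ∏ i ∈ s, (1 + ε i) / 2 +
      (∑ r ∈ s, (1 - ε r) * ∏ i ∈ s.filter (fun i => i ≠ r), (1 + ε i) / 2) / 2 ≤ 1 := by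
  induction s using Finset.induction_on with
  | empty => simp
  | insert a s ha ih =>
    have hprod : 0 ≤ ∏ i ∈ s, (1 + ε i) / 2 :=
      Finset.prod_nonneg fun i _ => by rcases hε i with h | h <;> rw [h] <;> norm_num
    have hself : (insert a s).filter (fun i => i ≠ a) = s := by
      ext i
      grind
    have hsum : ∑ r ∈ s, (1 - ε r) * ∏ i ∈ (insert a s).filter (fun i => i ≠ r), (1 + ε i) / 2 =
        (1 + ε a) / 2 *
          ∑ r ∈ s, (1 - ε r) * ∏ i ∈ s.filter (fun i => i ≠ r), (1 + ε i) / 2 := by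
      rw [Finset.mul_sum]
      refine Finset.sum_congr rfl fun r hr => ?_
      have har : a ≠ r := fun h => ha (h ▸ hr)
      rw [Finset.filter_insert, if_pos har, Finset.prod_insert (by simp [ha])]
      ring
    rw [Finset.sum_insert ha, hself, hsum, Finset.prod_insert ha]
    obtain ⟨h0, h1, h2⟩ := ih
    rcases hε a with h | h <;> rw [h] <;> refine ⟨?_, ?_, ?_⟩ <;> linarith


/-- Maximal eigenvalue of `Q = (1/S) ∑_r Π_r^⊥ ⊗_{i≠r} (I+Π_i)/2`: over all joint
eigenvalue strings `ε ∈ {0,1}^S`, the value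
`(1/S) · ∑_r (1 - ε r) · ∏_{i ≠ r} (1 + ε i)/2` is at most `1/S`, and `1/S` is attained. -/
theorem interactive_protocol_max_eigenvalue (S : ℕ) (hS : 1 ≤ S) :
    IsGreatest
      {v : ℝ | ∃ ε : Fin S → ℝ, (∀ i, ε i = 0 ∨ ε i = 1) ∧
        v = (1 / (S : ℝ)) *
          ∑ r : Fin S, (1 - ε r) *
            ∏ i ∈ Finset.univ.filter (fun i => i ≠ r), (1 + ε i) / 2}
      (1 / (S : ℝ)) := by
  have hS0 : (0 : ℝ) ≤ 1 / (S : ℝ) := by positivity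
  constructor
  · let r₀ : Fin S := ⟨0, hS⟩
    refine ⟨fun i => if i = r₀ then 0 else 1, fun i => by by_cases h : i = r₀ <;> simp [h], ?_⟩
    rw [Finset.sum_eq_single r₀ (fun r _ hr => by simp [hr]) (by simp),
      Finset.prod_eq_one fun i hi => ?_]
    · simp
    · simp only [if_neg (Finset.mem_filter.mp hi).2]
      norm_num
  · rintro v ⟨ε, hε, rfl⟩
    exact mul_le_of_le_one_right hS0 (sum_one_sub_mul_prod_half_bounds ε hε Finset.univ).2.1
end

section
/- Let S ≥ 1 be a natural number, let n be a finite type, and let P : Fin S → Matrix n n ℂ be a family of matrices such that each P i is Hermitian, satisfies (P i) * (P i) = P i, and the family commutes pairwise (P i * P j = P j * P i for all i, j). Define Q := (1/S) • ∑_{r ∈ Fin S} (1 − P r) * ∏_{i ∈ Fin S, i ≠ r} ((1 + P i)/2), where 1 denotes the identity matrix. Then (1/S) • 1 − Q is positive semidefinite; that is, Q ≤ (1/S) • 1 in the Loewner order. -/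
open scoped ComplexOrder

namespace Matrix

variable {n ι : Type*} [Fintype n]

/-- Multiplying a positive semidefinite matrix by a commuting orthogonal projection preserves
positive semidefiniteness. -/
lemma PosSemidef.proj_mul {P X : Matrix n n ℂ} (hX : X.PosSemidef) (hP : P.IsHermitian)
    (hPP : P * P = P) (hPX : Commute P X) : (P * X).PosSemidef := by
  have h := hX.mul_mul_conjTranspose_same P
  rwa [hP.eq, mul_assoc, ← hPX.eq, ← mul_assoc, hPP] at h

variable [DecidableEq n]

/-- Positive semidefinite matrices can be glued along a commuting orthogonal projection. -/
lemma PosSemidef.proj_mul_add {P X Y : Matrix n n ℂ} (hX : X.PosSemidef) (hY : Y.PosSemidef)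
    (hP : P.IsHermitian) (hPP : P * P = P) (hPX : Commute P X) (hPY : Commute P Y) :
    (P * X + (1 - P) * Y).PosSemidef := by
  refine (hX.proj_mul hP hPP hPX).add (hY.proj_mul (isHermitian_one.sub hP) ?_ ?_)
  · exact (IsIdempotentElem.one_sub hPP).eq
  · exact (Commute.one_left Y).sub_left hPY

/-- The product of the matrices `(1 + P i) / 2` along a list. -/
noncomputable def halfProd (P : ι → Matrix n n ℂ) (l : List ι) : Matrix n n ℂ :=
  (l.map fun i => (1 / 2 : ℂ) • (1 + P i)).prod

/-- The sum over `r` in a list of `1 - P r` times the product of the other `(1 + P i) / 2`. -/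
noncomputable def failSum [DecidableEq ι] (P : ι → Matrix n n ℂ) (l : List ι) : Matrix n n ℂ :=
  (l.map fun r => (1 - P r) * halfProd P (l.filter fun i => i ≠ r)).sum

variable {P : ι → Matrix n n ℂ}

lemma halfProd_cons (a : ι) (l : List ι) :
    halfProd P (a :: l) = ((1 / 2 : ℂ) • (1 + P a)) * halfProd P l := by
  simp [halfProd]

lemma commute_half (hComm : ∀ i j, Commute (P i) (P j)) (i j : ι) :
    Commute (P i) ((1 / 2 : ℂ) • (1 + P j)) :=
  ((Commute.one_right _).add_right (hComm i j)).smul_right _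

lemma commute_halfProd (hComm : ∀ i j, Commute (P i) (P j)) (i : ι) (l : List ι) :
    Commute (P i) (halfProd P l) := by
  refine Commute.list_prod_right _ _ fun x hx => ?_
  obtain ⟨j, -, rfl⟩ := List.mem_map.1 hx
  exact commute_half hComm i j

lemma commute_failSum [DecidableEq ι] (hComm : ∀ i j, Commute (P i) (P j)) (i : ι) (l : List ι) :
    Commute (P i) (failSum P l) := by
  refine Commute.list_sum_right _ _ fun x hx => ?_
  obtain ⟨j, -, rfl⟩ := List.mem_map.1 hx
  exact ((Commute.one_right _).sub_right (hComm i j)).mul_right (commute_halfProd hComm i _)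

lemma failSum_cons [DecidableEq ι] (hComm : ∀ i j, Commute (P i) (P j)) {a : ι} {l : List ι} (ha : a ∉ l) :
    failSum P (a :: l) =
      (1 - P a) * halfProd P l + ((1 / 2 : ℂ) • (1 + P a)) * failSum P l := by
  have h_filter : l.filter (fun i => i ≠ a) = l :=
    List.filter_eq_self.2 fun i hi => decide_eq_true (ne_of_mem_of_not_mem hi ha)
  rw [failSum, List.map_cons, List.sum_cons, List.filter_cons_of_neg (by simp), h_filter,
    failSum, ← List.sum_map_mul_left]
  congr 2
  refine List.map_congr_left fun r hr => ?_
  have har : a ≠ r := (ne_of_mem_of_not_mem hr ha).symm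
  rw [List.filter_cons_of_pos (by simpa using har), halfProd_cons, ← mul_assoc, ← mul_assoc,
    ((Commute.one_left _).sub_left (commute_half hComm r a)).eq]

/-- The third bound is the claim of interest; the first two make the induction on the list work. -/
lemma posSemidef_one_sub_failSum_aux [DecidableEq ι] (hHerm : ∀ i, (P i).IsHermitian)
    (hProj : ∀ i, P i * P i = P i) (hComm : ∀ i j, Commute (P i) (P j)) {l : List ι}
    (hl : l.Nodup) :
    (1 - halfProd P l).PosSemidef ∧
      (1 - halfProd P l - (1 / 2 : ℂ) • failSum P l).PosSemidef ∧
      (1 - failSum P l).PosSemidef := by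
  induction l with
  | nil => simp [halfProd, failSum, PosSemidef.zero, PosSemidef.one]
  | cons a l ih =>
    obtain ⟨ha, hl⟩ := List.nodup_cons.1 hl
    obtain ⟨h₀, h₁, h₂⟩ := ih hl
    have h_half : (0 : ℂ) ≤ 1 / 2 := by positivity
    have cA := commute_halfProd hComm a l
    have cB := commute_failSum hComm a l
    have c₀ := (Commute.one_right (P a)).sub_right cA
    have c₁ := c₀.sub_right (cB.smul_right (1 / 2 : ℂ))
    have c₂ := (Commute.one_right (P a)).sub_right cB
    rw [halfProd_cons, failSum_cons hComm ha]
    refine ⟨?_, ?_, ?_⟩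
    · convert h₀.proj_mul_add ((PosSemidef.one.add h₀).smul h_half) (hHerm a) (hProj a) c₀
        (((Commute.one_right _).add_right c₀).smul_right _) using 1
      simp only [mul_add, add_mul, mul_sub, sub_mul, smul_mul_assoc, mul_smul_comm, mul_one,
        one_mul]
      module
    · convert h₁.proj_mul_add ((h₁.add h₀).smul h_half) (hHerm a) (hProj a) c₁
        ((c₁.add_right c₀).smul_right _) using 1
      simp only [mul_add, add_mul, mul_sub, sub_mul, smul_mul_assoc, mul_smul_comm, mul_one,
        one_mul]
      module
    · convert h₂.proj_mul_add h₁ (hHerm a) (hProj a) c₂ c₁ using 1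
      simp only [add_mul, mul_sub, sub_mul, smul_mul_assoc, mul_smul_comm, mul_one,
        one_mul]
      module

end Matrix

/-- Soundness bound for the interactive protocol: if `P i` are pairwise commuting
orthogonal projections (Hermitian idempotents), then
`Q = (1/S) ∑_r (1 - P r) * ∏_{i ≠ r} (1 + P i)/2` satisfies `Q ≤ (1/S) • 1`
in the Loewner order, i.e. `(1/S) • 1 - Q` is positive semidefinite.
(The product over `i ≠ r` is taken in the canonical order of `Fin S`; the factors
commute, so the order is immaterial.) -/
theorem interactive_protocol_Q_le (S : ℕ) (hS : 1 ≤ S) (n : Type*) [Fintype n]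
    [DecidableEq n] (P : Fin S → Matrix n n ℂ)
    (hHerm : ∀ i, (P i).IsHermitian)
    (hProj : ∀ i, P i * P i = P i)
    (hComm : ∀ i j, P i * P j = P j * P i) :
    ((1 / (S : ℂ)) • (1 : Matrix n n ℂ) -
      (1 / (S : ℂ)) • ∑ r : Fin S,
        (1 - P r) *
          (((List.finRange S).filter (fun i => i ≠ r)).map
            (fun i => (1 / 2 : ℂ) • (1 + P i))).prod).PosSemidef := by
  rw [← smul_sub, Fin.sum_univ_def]
  exact (Matrix.posSemidef_one_sub_failSum_aux hHerm hProj hComm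
    (List.nodup_finRange S)).2.2.smul (by positivity)
end

section
/- Let S ≥ 1 be a natural number. For every function ε : Fin S → ℝ taking values in {0,1}, one has (1/S) · ∑_{r ∈ Fin S} (1 − ε r) · ∏_{i < r} (1 + ε i)/2 ≤ (2 − 2^{1−S})/S, with equality when ε is identically 0 (so that the r-th summand equals 2^{−(r−1)}); moreover (2 − 2^{1−S})/S < 2/S. Equivalently, (2 − 2^{1−S})/S is the greatest element of the set { (1/S) · ∑_{r} (1 − ε r) · ∏_{i < r} (1 + ε i)/2 : ε ∈ {0,1}^S } and this maximum is strictly less than 2/S. -/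
/-- Splitting off the first index of the sum `∑_r (1 - ε r) · ∏_{i < r} (1 + ε i)/2`. -/
theorem sum_one_sub_mul_prod_half_succ {n : ℕ} (ε : Fin (n + 1) → ℝ) :
    ∑ r : Fin (n + 1), (1 - ε r) *
        ∏ i ∈ Finset.univ.filter (fun i => i < r), (1 + ε i) / 2
      = (1 - ε 0) + (1 + ε 0) / 2 *
        ∑ r : Fin n, (1 - ε r.succ) *
          ∏ i ∈ Finset.univ.filter (fun i => i < r), (1 + ε i.succ) / 2 := by
  simp only [Finset.prod_filter, Fin.sum_univ_succ, Fin.prod_univ_succ, Fin.not_lt_zero,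
    Fin.succ_pos, Fin.succ_lt_succ_iff, if_true, if_false, Finset.prod_const_one, mul_one,
    Finset.mul_sum]
  congr 1
  exact Finset.sum_congr rfl fun r _ => by ring

theorem sum_one_sub_mul_prod_half_le {n : ℕ} (ε : Fin n → ℝ)
    (hε : ∀ i, 0 ≤ ε i ∧ ε i ≤ 1) :
    ∑ r : Fin n, (1 - ε r) *
        ∏ i ∈ Finset.univ.filter (fun i => i < r), (1 + ε i) / 2
      ≤ 2 - 2 / 2 ^ n := by
  induction n with
  | zero => simp
  | succ n ih =>
    rw [sum_one_sub_mul_prod_half_succ]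
    have h := ih (fun i => ε i.succ) fun i => hε i.succ
    have h0 := (hε 0).1
    have hp : (0 : ℝ) < 2 / 2 ^ n := by positivity
    have hs : (2 : ℝ) / 2 ^ (n + 1) = 2 / 2 ^ n / 2 := by rw [pow_succ]; ring
    rw [hs]
    have hm := mul_le_mul_of_nonneg_left h (by linarith : (0 : ℝ) ≤ (1 + ε 0) / 2)
    nlinarith [mul_nonneg h0 hp.le]

theorem sum_one_sub_mul_prod_half_zero (n : ℕ) :
    ∑ r : Fin n, (1 - (0 : ℝ)) *
        ∏ i ∈ Finset.univ.filter (fun i => i < r), (1 + (0 : ℝ)) / 2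
      = 2 - 2 / 2 ^ n := by
  induction n with
  | zero => simp
  | succ n ih =>
    rw [sum_one_sub_mul_prod_half_succ (fun _ => 0), ih, pow_succ]
    ring

/-- Maximal eigenvalue of the operator `Q` appearing in the aborting protocol:
over all joint eigenvalue strings `ε ∈ {0,1}^S`, the value
`(1/S) · ∑_r (1 - ε r) · ∏_{i < r} (1 + ε i)/2` is at most `(2 - 2^{1-S})/S`,
with equality for `ε ≡ 0`; this maximum is strictly less than `2/S`. -/
theorem aborting_protocol_max_eigenvalue (S : ℕ) (hS : 1 ≤ S) :
    ((1 / (S : ℝ)) *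
        ∑ r : Fin S, (1 - (0 : ℝ)) *
          ∏ i ∈ Finset.univ.filter (fun i => i < r), (1 + (0 : ℝ)) / 2)
      = (2 - 2 ^ (1 - (S : ℤ))) / (S : ℝ) ∧
    IsGreatest
      {v : ℝ | ∃ ε : Fin S → ℝ, (∀ i, ε i = 0 ∨ ε i = 1) ∧
        v = (1 / (S : ℝ)) *
          ∑ r : Fin S, (1 - ε r) *
            ∏ i ∈ Finset.univ.filter (fun i => i < r), (1 + ε i) / 2}
      ((2 - 2 ^ (1 - (S : ℤ))) / (S : ℝ)) ∧
    (2 - 2 ^ (1 - (S : ℤ))) / (S : ℝ) < 2 / (S : ℝ) := by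
  have hpow : (2 : ℝ) ^ (1 - (S : ℤ)) = 2 / 2 ^ S := by
    rw [zpow_sub₀ two_ne_zero, zpow_one, zpow_natCast]
  have hS0 : (0 : ℝ) < S := by exact_mod_cast hS
  have hzero : (1 / (S : ℝ)) * ∑ r : Fin S, (1 - (0 : ℝ)) *
      ∏ i ∈ Finset.univ.filter (fun i => i < r), (1 + (0 : ℝ)) / 2
      = (2 - 2 ^ (1 - (S : ℤ))) / (S : ℝ) := by
    rw [sum_one_sub_mul_prod_half_zero, hpow, one_div_mul_eq_div]
  refine ⟨hzero, ⟨⟨fun _ => 0, fun _ => Or.inl rfl, hzero.symm⟩, ?_⟩, ?_⟩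
  · rintro v ⟨ε, hε, rfl⟩
    rw [hpow, one_div_mul_eq_div]
    refine div_le_div_of_nonneg_right (sum_one_sub_mul_prod_half_le ε fun i => ?_) hS0.le
    rcases hε i with h | h <;> norm_num [h]
  · have : (0 : ℝ) < 2 ^ (1 - (S : ℤ)) := by positivity
    exact div_lt_div_of_pos_right (by linarith) hS0
end

section
/- Let S ≥ 1 be a natural number, let n be a finite type, and let P : Fin S → Matrix n n ℂ be a family of matrices such that each P i is Hermitian, satisfies (P i) * (P i) = P i, and the family commutes pairwise. Define Q := (1/S) • ∑_{r ∈ Fin S} (1 − P r) * ∏_{i ∈ Fin S, i < r} ((1 + P i)/2). Then ((2 − 2^{1−S})/S) • 1 − Q is positive semidefinite; in particular (2/S) • 1 − Q is positive semidefinite, i.e. Q ≤ (2/S) • 1 in the Loewner order. -/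
open scoped ComplexOrder

/-- A telescoping sum of ordered products of pairwise commuting elements of a ring. -/
theorem sum_one_sub_mul_prod_filter_lt {R : Type*} [Ring R] {S : ℕ} (f : Fin S → R)
    (hf : ∀ i j, Commute (f i) (f j)) :
    ∑ r : Fin S, (1 - f r) * (((List.finRange S).filter (fun i => i < r)).map f).prod =
      1 - ((List.finRange S).map f).prod := by
  induction S with
  | zero => simp
  | succ S ih =>
    have hsucc (r : Fin S) :
        (((List.finRange (S + 1)).filter (fun i => i < r.castSucc)).map f).prod =
          (((List.finRange S).filter (fun i => i < r)).map (fun i => f i.castSucc)).prod := by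
      simp [List.finRange_succ_last, List.filter_append, List.filter_map, Function.comp_def,
        Fin.not_lt.mpr (Fin.le_last _)]
    have hlast :
        (((List.finRange (S + 1)).filter (fun i => i < Fin.last S)).map f).prod =
          ((List.finRange S).map (fun i => f i.castSucc)).prod := by
      simp [List.finRange_succ_last, List.filter_append, List.filter_map, Function.comp_def,
        Fin.castSucc_lt_last]
    have hcomm : Commute (f (Fin.last S)) ((List.finRange S).map (fun i => f i.castSucc)).prod :=
      Commute.list_prod_right _ _ (by simp [hf])
    have hall : ((List.finRange (S + 1)).map f).prod =
        ((List.finRange S).map (fun i => f i.castSucc)).prod * f (Fin.last S) := by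
      simp [List.finRange_succ_last, Function.comp_def]
    rw [Fin.sum_univ_castSucc, hlast, hall]
    simp only [hsucc]
    rw [ih (fun i => f i.castSucc) (fun i j => hf _ _), sub_mul, one_mul, hcomm.eq]
    abel

/-- A product of averages of the identity with commuting orthogonal projections is bounded below
by the corresponding power of `1 / 2`. -/
theorem posSemidef_prod_half_one_add_sub {ι n : Type*} [Fintype n] [DecidableEq n]
    (P : ι → Matrix n n ℂ) (hHerm : ∀ i, (P i).IsHermitian) (hProj : ∀ i, P i * P i = P i)
    (hComm : ∀ i j, Commute (P i) (P j)) (l : List ι) :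
    ((l.map (fun i => (1 / 2 : ℂ) • (1 + P i))).prod -
      (1 / 2 : ℂ) ^ l.length • (1 : Matrix n n ℂ)).PosSemidef := by
  have half_nonneg : (0 : ℂ) ≤ 1 / 2 := by
    rw [Complex.le_def]
    norm_num
  induction l with
  | nil => simpa using Matrix.PosSemidef.zero
  | cons i l ih =>
    simp only [List.map_cons, List.prod_cons, List.length_cons]
    set A := (l.map (fun i => (1 / 2 : ℂ) • (1 + P i))).prod
    have hcomm : Commute (P i) A := by
      refine Commute.list_prod_right _ _ fun B hB => ?_
      obtain ⟨j, -, rfl⟩ := List.mem_map.mp hB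
      exact ((Commute.one_right _).add_right (hComm i j)).smul_right _
    have hApos : A.PosSemidef := by
      simpa using ih.add (Matrix.PosSemidef.one.smul (pow_nonneg half_nonneg l.length))
    have hPA : (P i * A).PosSemidef := by
      have h := hApos.mul_mul_conjTranspose_same (P i)
      rwa [(hHerm i).eq, mul_assoc, ← hcomm.eq, ← mul_assoc, hProj] at h
    convert (ih.add hPA).smul half_nonneg using 1
    rw [pow_succ', mul_smul, smul_mul_assoc, add_mul, one_mul]
    module

/-- Security bound for the aborting protocol: if `P i` are pairwise commuting
orthogonal projections (Hermitian idempotents), then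
`Q = (1/S) ∑_r (1 - P r) * ∏_{i < r} (1 + P i)/2` satisfies
`Q ≤ ((2 - 2^{1-S})/S) • 1`, and in particular `Q ≤ (2/S) • 1`, in the Loewner
order (the differences are positive semidefinite). The product over `i < r` is
taken in the canonical order of `Fin S`; the factors commute. -/
theorem aborting_protocol_Q_le (S : ℕ) (hS : 1 ≤ S) (n : Type*) [Fintype n]
    [DecidableEq n] (P : Fin S → Matrix n n ℂ)
    (hHerm : ∀ i, (P i).IsHermitian)
    (hProj : ∀ i, P i * P i = P i)
    (hComm : ∀ i j, P i * P j = P j * P i) :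
    ((((2 - 2 ^ (1 - (S : ℤ))) / (S : ℝ) : ℝ) : ℂ) • (1 : Matrix n n ℂ) -
      (1 / (S : ℂ)) • ∑ r : Fin S,
        (1 - P r) *
          (((List.finRange S).filter (fun i => i < r)).map
            (fun i => (1 / 2 : ℂ) • (1 + P i))).prod).PosSemidef ∧
    (((2 / (S : ℝ) : ℝ) : ℂ) • (1 : Matrix n n ℂ) -
      (1 / (S : ℂ)) • ∑ r : Fin S,
        (1 - P r) *
          (((List.finRange S).filter (fun i => i < r)).map
            (fun i => (1 / 2 : ℂ) • (1 + P i))).prod).PosSemidef := by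
  have hprod := posSemidef_prod_half_one_add_sub P hHerm hProj hComm (List.finRange S)
  rw [List.length_finRange] at hprod
  have htele := sum_one_sub_mul_prod_filter_lt (fun i => (1 / 2 : ℂ) • (1 + P i)) fun i j =>
    (((Commute.one_left _).add_left ((Commute.one_right _).add_right
      (hComm i j))).smul_left _).smul_right _
  set A := ((List.finRange S).map (fun i => (1 / 2 : ℂ) • (1 + P i))).prod
  have hsum : ∑ r : Fin S, (1 - P r) *
      (((List.finRange S).filter (fun i => i < r)).map
        (fun i => (1 / 2 : ℂ) • (1 + P i))).prod = (2 : ℂ) • (1 - A) := by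
    rw [← htele, Finset.smul_sum]
    refine Finset.sum_congr rfl fun r _ => ?_
    rw [← smul_mul_assoc]
    congr 1
    module
  have hcoeff : (0 : ℂ) ≤ ((2 / (S : ℝ) : ℝ) : ℂ) :=
    Complex.zero_le_real.mpr (by positivity)
  have hpow : (2 : ℂ) ^ (1 - (S : ℤ)) = 2 * (1 / 2) ^ S := by
    rw [zpow_sub₀ two_ne_zero, zpow_one, zpow_natCast, one_div, inv_pow, div_eq_mul_inv]
  have hsharp := hprod.smul hcoeff
  rw [hsum]
  have hfirst : (((2 - 2 ^ (1 - (S : ℤ))) / (S : ℝ) : ℝ) : ℂ) • (1 : Matrix n n ℂ) -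
      (1 / (S : ℂ)) • (2 : ℂ) • (1 - A) =
      ((2 / (S : ℝ) : ℝ) : ℂ) • (A - (1 / 2 : ℂ) ^ S • 1) := by
    push_cast
    rw [hpow]
    module
  refine ⟨hfirst ▸ hsharp, ?_⟩
  have hgap : (0 : ℂ) ≤ ((2 / (S : ℝ) * (1 / 2) ^ S : ℝ) : ℂ) :=
    Complex.zero_le_real.mpr (by positivity)
  convert hsharp.add (Matrix.PosSemidef.one.smul hgap) using 1
  push_cast
  module
end

section
/- Let n be a finite type and let U, V ∈ Matrix n n ℂ be Hermitian matrices with U * U = 1, V * V = 1, and U * V = V * U. Define M := (1/2) • ((1 + U)/2 + (1 + V)/2) and Π := (1/4) • (1 + U + V + U * V). Then (1/2) • (1 + Π) − M is positive semidefinite; that is, M ≤ (1 + Π)/2 in the Loewner order. -/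
open scoped ComplexOrder

/-- The product of the unnormalised projectors `1 - U` and `1 - V` attached to two commuting
Hermitian involutions is positive semidefinite. -/
theorem Matrix.IsHermitian.posSemidef_one_sub_mul_one_sub {n : Type*} [Fintype n] [DecidableEq n]
    {U V : Matrix n n ℂ} (hU : U.IsHermitian) (hV : V.IsHermitian)
    (hU2 : U * U = 1) (hV2 : V * V = 1) (hUV : U * V = V * U) :
    ((1 - U) * (1 - V)).PosSemidef := by
  have hcomm : (1 - V) * (1 - U) = (1 - U) * (1 - V) := by
    simp only [mul_sub, sub_mul, one_mul, mul_one, hUV]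
    abel
  have hsq {W : Matrix n n ℂ} (hW : W * W = 1) : (1 - W) * (1 - W) = (2 : ℂ) • (1 - W) := by
    simp only [mul_sub, sub_mul, one_mul, mul_one, hW]
    module
  have hself : ((1 - U) * (1 - V)).conjTranspose * ((1 - U) * (1 - V)) =
      (4 : ℂ) • ((1 - U) * (1 - V)) := by
    calc
      _ = (1 - V) * (1 - U) * ((1 - U) * (1 - V)) := by
        simp [Matrix.conjTranspose_mul, hU.eq, hV.eq]
      _ = (1 - U) * (1 - V) * ((1 - V) * (1 - U)) := by rw [hcomm]
      _ = (1 - U) * ((1 - V) * (1 - V)) * (1 - U) := by simp only [mul_assoc]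
      _ = (2 : ℂ) • ((1 - U) * ((1 - V) * (1 - U))) := by
        rw [hsq hV2, mul_smul_comm, smul_mul_assoc, mul_assoc]
      _ = (2 : ℂ) • ((1 - U) * (1 - U) * (1 - V)) := by rw [hcomm, mul_assoc]
      _ = _ := by
        rw [hsq hU2, smul_mul_assoc, smul_smul]
        norm_num
  have h := (Matrix.posSemidef_conjTranspose_mul_self ((1 - U) * (1 - V))).smul
    (show (0 : ℂ) ≤ ((1 / 4 : ℝ) : ℂ) by exact_mod_cast (by norm_num : (0 : ℝ) ≤ 1 / 4))
  rw [hself, smul_smul] at h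
  norm_num at h
  exact h

/-- Key operator inequality in the soundness proof: for commuting Hermitian
involutions `U, V`, the acceptance POVM element
`M = (1/2)((1+U)/2 + (1+V)/2)` satisfies `M ≤ (1 + Π)/2` in the Loewner order,
where `Π = (1/4)(1 + U + V + UV)`. -/
theorem acceptance_le_half_one_add_proj (n : Type*) [Fintype n] [DecidableEq n]
    (U V : Matrix n n ℂ)
    (hU : U.IsHermitian) (hV : V.IsHermitian)
    (hU2 : U * U = 1) (hV2 : V * V = 1)
    (hUV : U * V = V * U) :
    ((1 / 2 : ℂ) • (1 + (1 / 4 : ℂ) • (1 + U + V + U * V)) -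
      (1 / 2 : ℂ) • ((1 / 2 : ℂ) • (1 + U) + (1 / 2 : ℂ) • (1 + V))).PosSemidef := by
  have h := (hU.posSemidef_one_sub_mul_one_sub hV hU2 hV2 hUV).smul
    (show (0 : ℂ) ≤ ((1 / 8 : ℝ) : ℂ) by exact_mod_cast (by norm_num : (0 : ℝ) ≤ 1 / 8))
  convert h using 1
  push_cast
  simp only [mul_sub, sub_mul, one_mul, mul_one]
  module
end

section
/- Let n be a finite type, let U, V ∈ Matrix n n ℂ be Hermitian with U * U = 1, V * V = 1, U * V = V * U, and set M := (1/2) • ((1 + U)/2 + (1 + V)/2) and Π := (1/4) • (1 + U + V + U * V). Let ρ ∈ Matrix n n ℂ be positive semidefinite with trace 1. Then the real part of (ρ * M).trace is at most (1 + the real part of (ρ * Π).trace)/2. In other words, writing F for Re Tr(ρ Π), the acceptance probability Re Tr(ρ M) satisfies Tr(ρ M) ≤ (1 + F)/2. -/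
open scoped ComplexOrder

/-- A positive semidefinite matrix has nonnegative overlap with the product of the complements
of two commuting Hermitian involutions. -/
lemma Matrix.PosSemidef.trace_mul_one_sub_mul_one_sub_nonneg {n : Type*} [Fintype n]
    [DecidableEq n] {U V ρ : Matrix n n ℂ} (hρ : ρ.PosSemidef)
    (hU : U.IsHermitian) (hV : V.IsHermitian)
    (hU2 : U * U = 1) (hV2 : V * V = 1) (hUV : U * V = V * U) :
    0 ≤ (ρ * ((1 - U) * (1 - V))).trace.re := by
  have hcomm : (1 - U) * (1 - V) = (1 - V) * (1 - U) := by
    noncomm_ring [hUV]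
  have hsq {W : Matrix n n ℂ} (hW : W * W = 1) : (1 - W) * (1 - W) = (2 : ℂ) • (1 - W) := by
    simp only [two_smul, sub_mul, mul_sub, hW, one_mul, mul_one]
    abel
  have hH : ((1 - U) * (1 - V)).conjTranspose = (1 - U) * (1 - V) := by
    rw [Matrix.conjTranspose_mul, Matrix.conjTranspose_sub, Matrix.conjTranspose_sub,
      Matrix.conjTranspose_one, hU.eq, hV.eq, hcomm]
  have hS : (1 - U) * (1 - V) * ((1 - U) * (1 - V)) = (4 : ℂ) • ((1 - U) * (1 - V)) := by
    calc (1 - U) * (1 - V) * ((1 - U) * (1 - V))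
        = (1 - U) * ((1 - V) * (1 - U)) * (1 - V) := by simp only [mul_assoc]
      _ = ((1 - U) * (1 - U)) * ((1 - V) * (1 - V)) := by rw [← hcomm]; simp only [mul_assoc]
      _ = (4 : ℂ) • ((1 - U) * (1 - V)) := by
        rw [hsq hU2, hsq hV2, smul_mul_smul_comm]; norm_num
  have h := (hρ.conjTranspose_mul_mul_same ((1 - U) * (1 - V))).trace_nonneg
  rw [hH, mul_assoc, Matrix.trace_mul_comm, mul_assoc, hS, Matrix.mul_smul,
    Matrix.trace_smul] at h
  have hre := (Complex.le_def.mp h).1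
  simp only [Complex.zero_re, smul_eq_mul, Complex.mul_re, Complex.re_ofNat, Complex.im_ofNat,
    zero_mul, sub_zero] at hre
  linarith

/-- For commuting Hermitian involutions `U, V`, the acceptance POVM element
`M = (1/2)((1+U)/2 + (1+V)/2)` and the projection `Π = (1/4)(1 + U + V + UV)`
satisfy, for every density matrix `ρ` (positive semidefinite, unit trace):
`Re Tr(ρ M) ≤ (1 + Re Tr(ρ Π))/2`, i.e. the acceptance probability is at most
`(1 + F)/2` where `F = Re Tr(ρ Π)` is the fidelity to the projector. -/
theorem acceptance_prob_le_half_one_add_fidelity (n : Type*) [Fintype n]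
    [DecidableEq n] (U V : Matrix n n ℂ)
    (hU : U.IsHermitian) (hV : V.IsHermitian)
    (hU2 : U * U = 1) (hV2 : V * V = 1)
    (hUV : U * V = V * U)
    (ρ : Matrix n n ℂ) (hρ : ρ.PosSemidef) (hρtr : ρ.trace = 1) :
    ((ρ * ((1 / 2 : ℂ) • ((1 / 2 : ℂ) • (1 + U) + (1 / 2 : ℂ) • (1 + V)))).trace).re ≤
      (1 + ((ρ * ((1 / 4 : ℂ) • (1 + U + V + U * V))).trace).re) / 2 := by
  have h := hρ.trace_mul_one_sub_mul_one_sub_nonneg hU hV hU2 hV2 hUV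
  simp only [mul_sub, sub_mul, mul_add, Matrix.mul_smul, smul_add, mul_one, one_mul,
    Matrix.trace_add, Matrix.trace_sub, Matrix.trace_smul, hρtr, smul_eq_mul] at h ⊢
  norm_num at h ⊢
  linarith
end

section
/- Let m be a finite type, let X := !![0, 1; 1, 0] and Z := !![1, 0; 0, −1] be the 2×2 Pauli matrices over ℂ, and let A, B ∈ Matrix m m ℂ be Hermitian with A * A = 1, B * B = 1, and A * B = − B * A. On ℂ² ⊗ ℂ^m (realised via the Kronecker product of matrices), define Π := (1/4) • (1 ⊗ₖ 1 + X ⊗ₖ A + (Z * X) ⊗ₖ (B * A) + Z ⊗ₖ B). Then for every vector ψ indexed by Fin 2 × m with Π.mulVec ψ = ψ and ⟨ψ, ψ⟩ = 1, and for every matrix M ∈ Matrix (Fin 2) (Fin 2) ℂ, one has ⟨ψ, (M ⊗ₖ 1).mulVec ψ⟩ = (Tr M)/2. -/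
open Matrix Kronecker

/-- The `i`-th block of `(M ⊗ C) ψ`, in terms of the blocks of `ψ`. -/
theorem kronecker_mulVec_block {m : Type*} [Fintype m]
    (M : Matrix (Fin 2) (Fin 2) ℂ) (C : Matrix m m ℂ) (ψ : Fin 2 × m → ℂ) (i : Fin 2) (k : m) :
    (M ⊗ₖ C).mulVec ψ (i, k) =
      M i 0 * C.mulVec (fun l => ψ (0, l)) k + M i 1 * C.mulVec (fun l => ψ (1, l)) k := by
  simp [mulVec, dotProduct, Fintype.sum_prod_type, Fin.sum_univ_two, Finset.mul_sum, mul_assoc]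

/-- If `B` is an involution and `c • u = e + c' • B e` with `c ≠ 0`, `c' * c' = 1`, then `u` is an
eigenvector of `B` with eigenvalue `c'`. -/
theorem mulVec_eq_smul_of_smul_eq {m : Type*} [Fintype m] [DecidableEq m]
    {B : Matrix m m ℂ} (hB2 : B * B = 1) {u e : m → ℂ} {c c' : ℂ} (hc : c ≠ 0)
    (hc' : c' * c' = 1) (h : c • u = e + c' • B.mulVec e) : B.mulVec u = c' • u := by
  have h1 : c • B.mulVec u = c • c' • u := by
    rw [← mulVec_smul, smul_comm, h, mulVec_add, mulVec_smul, mulVec_mulVec, hB2, one_mulVec,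
      smul_add, smul_smul, hc', one_smul, add_comm]
  exact smul_right_injective _ hc h1

/-- A Hermitian matrix can be moved across the inner product. -/
theorem star_mulVec_dotProduct_of_isHermitian {m : Type*} [Fintype m] {A : Matrix m m ℂ}
    (hA : A.IsHermitian) (u v : m → ℂ) :
    star (A.mulVec u) ⬝ᵥ v = star u ⬝ᵥ A.mulVec v := by
  rw [star_mulVec, hA.eq, dotProduct_mulVec]

/-- Every unit vector in the range of
`Π = (1/4)(1 ⊗ 1 + X ⊗ A + ZX ⊗ BA + Z ⊗ B)`, with `X, Z` the Pauli matrices and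
`A, B` anticommuting Hermitian involutions, is maximally entangled between the
first (qubit) factor and the second: for every single-qubit observable `M`,
`⟨ψ, (M ⊗ 1) ψ⟩ = Tr(M)/2`. -/
theorem proj_range_maximally_entangled (m : Type*) [Fintype m] [DecidableEq m]
    (A B : Matrix m m ℂ)
    (hA : A.IsHermitian) (hB : B.IsHermitian)
    (hA2 : A * A = 1) (hB2 : B * B = 1)
    (hAB : A * B = -(B * A)) :
    ∀ ψ : Fin 2 × m → ℂ,
      ((1 / 4 : ℂ) • ((1 : Matrix (Fin 2) (Fin 2) ℂ) ⊗ₖ (1 : Matrix m m ℂ) +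
          (!![0, 1; 1, 0] : Matrix (Fin 2) (Fin 2) ℂ) ⊗ₖ A +
          ((!![1, 0; 0, -1] : Matrix (Fin 2) (Fin 2) ℂ) *
            (!![0, 1; 1, 0] : Matrix (Fin 2) (Fin 2) ℂ)) ⊗ₖ (B * A) +
          (!![1, 0; 0, -1] : Matrix (Fin 2) (Fin 2) ℂ) ⊗ₖ B)).mulVec ψ = ψ →
      star ψ ⬝ᵥ ψ = 1 →
      ∀ M : Matrix (Fin 2) (Fin 2) ℂ,
        star ψ ⬝ᵥ (M ⊗ₖ (1 : Matrix m m ℂ)).mulVec ψ = M.trace / 2 := by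
  intro ψ hψ hn M
  set u : m → ℂ := fun l => ψ (0, l) with hu
  set v : m → ℂ := fun l => ψ (1, l) with hv
  have hBA (w : m → ℂ) : (B * A).mulVec w = B.mulVec (A.mulVec w) := (mulVec_mulVec ..).symm
  have h0 : (4 : ℂ) • u = (u + A.mulVec v) + (1 : ℂ) • B.mulVec (u + A.mulVec v) := by
    funext k
    have := congrFun hψ (0, k)
    simp only [smul_mulVec, add_mulVec, Pi.smul_apply, Pi.add_apply, kronecker_mulVec_block,
      ← hu, ← hv, hBA, one_mulVec] at this
    simp [mulVec_add] at this ⊢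
    rw [show ψ (0, k) = u k from rfl] at this
    linear_combination (-4) * this
  have h1 : (4 : ℂ) • v = (v + A.mulVec u) + (-1 : ℂ) • B.mulVec (v + A.mulVec u) := by
    funext k
    have := congrFun hψ (1, k)
    simp only [smul_mulVec, add_mulVec, Pi.smul_apply, Pi.add_apply, kronecker_mulVec_block,
      ← hu, ← hv, hBA, one_mulVec] at this
    simp [mulVec_add] at this ⊢
    rw [show ψ (1, k) = v k from rfl] at this
    linear_combination (-4) * this
  have hBu : B.mulVec u = u := by
    simpa using mulVec_eq_smul_of_smul_eq hB2 (by norm_num) (by norm_num) h0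
  have hBv : B.mulVec v = -v := by
    simpa using mulVec_eq_smul_of_smul_eq hB2 (by norm_num) (by norm_num) h1
  have hBAu : B.mulVec (A.mulVec u) = -A.mulVec u := by
    rw [← hBA, ← neg_neg (B * A), ← hAB, neg_mulVec, ← mulVec_mulVec, hBu]
  have hvA : v = A.mulVec u := by
    funext k
    have := congrFun h1 k
    simp [mulVec_add, hBv, hBAu] at this
    linear_combination this / 2
  have huv : star u ⬝ᵥ v = 0 := by
    have := star_mulVec_dotProduct_of_isHermitian hB u v
    rw [hBu, hBv, dotProduct_neg] at this
    linear_combination this / 2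
  have hvu : star v ⬝ᵥ u = 0 := by
    rw [star_dotProduct, huv, star_zero]
  have hvv : star v ⬝ᵥ v = star u ⬝ᵥ u := by
    rw [hvA, star_mulVec_dotProduct_of_isHermitian hA, mulVec_mulVec, hA2, one_mulVec]
  have hsplit (φ : Fin 2 × m → ℂ) : star ψ ⬝ᵥ φ =
      (star u ⬝ᵥ fun k => φ (0, k)) + star v ⬝ᵥ fun k => φ (1, k) := by
    simp [dotProduct, Fintype.sum_prod_type, Fin.sum_univ_two, hu, hv]
  have hblock (i : Fin 2) : (fun k => (M ⊗ₖ (1 : Matrix m m ℂ)).mulVec ψ (i, k)) =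
      M i 0 • u + M i 1 • v := by
    funext k
    simp [kronecker_mulVec_block, hu, hv]
  rw [hsplit, ← hu, ← hv, hvv] at hn
  rw [hsplit, hblock, hblock, trace_fin_two]
  simp only [dotProduct_add, dotProduct_smul, huv, hvu, hvv, smul_eq_mul]
  linear_combination (M 0 0 + M 1 1) / 2 * hn
end
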